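/- arXiv:1704.05022 — 3 statements merged into one kernel-verified Lean document; each statement's English description precedes it below -/
import Mathlib

section
/- Theorem 5.2, formulas (5.40): in the case of general position the identities J₃ = −15·I₆·F⁷, J₁ = (I₃ + (14/5)·I₈)·F⁴, and J₄ = −(3·I₃ + (87/5)·I₈)·F⁹ hold on all of ℝ²; equivalently, Bagderina's invariants satisfy I₃^Bgd = 15 I₆, I₁^Bgd = I₃ + (14/5) I₈ and I₄^Bgd = 3 I₃ + (87/5) I₈. -/
open Function

noncomputable section

/-- Partial derivative in the first variable. -/
def pdx (f : ℝ → ℝ → ℝ) : ℝ → ℝ → ℝ := fun x y => deriv (fun t => f t y) x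

/-- Partial derivative in the second variable. -/
def pdy (f : ℝ → ℝ → ℝ) : ℝ → ℝ → ℝ := fun x y => deriv (fun t => f x t) y

def al0 (P Q R S : ℝ → ℝ → ℝ) : ℝ → ℝ → ℝ := fun x y =>
  pdx Q x y - pdy P x y + 2 * P x y * R x y - 2 * Q x y ^ 2

def al1 (P Q R S : ℝ → ℝ → ℝ) : ℝ → ℝ → ℝ := fun x y =>
  pdx R x y - pdy Q x y + P x y * S x y - Q x y * R x y

def al2 (P Q R S : ℝ → ℝ → ℝ) : ℝ → ℝ → ℝ := fun x y =>
  pdx S x y - pdy R x y + 2 * Q x y * S x y - 2 * R x y ^ 2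

def b1 (P Q R S : ℝ → ℝ → ℝ) : ℝ → ℝ → ℝ := fun x y =>
  pdx (al1 P Q R S) x y - pdy (al0 P Q R S) x y + R x y * al0 P Q R S x y - 2 * Q x y * al1 P Q R S x y + P x y * al2 P Q R S x y

def b2 (P Q R S : ℝ → ℝ → ℝ) : ℝ → ℝ → ℝ := fun x y =>
  pdx (al2 P Q R S) x y - pdy (al1 P Q R S) x y + S x y * al0 P Q R S x y - 2 * R x y * al1 P Q R S x y + Q x y * al2 P Q R S x y

def g10 (P Q R S : ℝ → ℝ → ℝ) : ℝ → ℝ → ℝ := fun x y =>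
  pdx (b1 P Q R S) x y - Q x y * b1 P Q R S x y + P x y * b2 P Q R S x y

def g11 (P Q R S : ℝ → ℝ → ℝ) : ℝ → ℝ → ℝ := fun x y =>
  pdx (b2 P Q R S) x y - R x y * b1 P Q R S x y + Q x y * b2 P Q R S x y

def g20 (P Q R S : ℝ → ℝ → ℝ) : ℝ → ℝ → ℝ := fun x y =>
  pdy (b1 P Q R S) x y - R x y * b1 P Q R S x y + Q x y * b2 P Q R S x y

def g21 (P Q R S : ℝ → ℝ → ℝ) : ℝ → ℝ → ℝ := fun x y =>
  pdy (b2 P Q R S) x y - S x y * b1 P Q R S x y + R x y * b2 P Q R S x y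

def J0 (P Q R S : ℝ → ℝ → ℝ) : ℝ → ℝ → ℝ := fun x y =>
  b2 P Q R S x y ^ 2 * g10 P Q R S x y - b1 P Q R S x y * b2 P Q R S x y * (g20 P Q R S x y + g11 P Q R S x y) + b1 P Q R S x y ^ 2 * g21 P Q R S x y

def Gam0 (P Q R S : ℝ → ℝ → ℝ) : ℝ → ℝ → ℝ := fun x y =>
  3 * b2 P Q R S x y * g10 P Q R S x y + b1 P Q R S x y * (g20 P Q R S x y - 4 * g11 P Q R S x y)

def Gam1 (P Q R S : ℝ → ℝ → ℝ) : ℝ → ℝ → ℝ := fun x y =>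
  b2 P Q R S x y * (4 * g20 P Q R S x y - g11 P Q R S x y) - 3 * b1 P Q R S x y * g21 P Q R S x y

def d10 (P Q R S : ℝ → ℝ → ℝ) : ℝ → ℝ → ℝ := fun x y =>
  pdx (g10 P Q R S) x y - 2 * Q x y * g10 P Q R S x y + P x y * (g20 P Q R S x y + g11 P Q R S x y) - 5 * al0 P Q R S x y * b1 P Q R S x y

def d20 (P Q R S : ℝ → ℝ → ℝ) : ℝ → ℝ → ℝ := fun x y =>
  pdx (g20 P Q R S) x y - R x y * g10 P Q R S x y + P x y * g21 P Q R S x y - 4 * al1 P Q R S x y * b1 P Q R S x y - al0 P Q R S x y * b2 P Q R S x y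

def d30 (P Q R S : ℝ → ℝ → ℝ) : ℝ → ℝ → ℝ := fun x y =>
  pdy (g20 P Q R S) x y - S x y * g10 P Q R S x y + Q x y * g21 P Q R S x y - 4 * al2 P Q R S x y * b1 P Q R S x y - al1 P Q R S x y * b2 P Q R S x y

def d11 (P Q R S : ℝ → ℝ → ℝ) : ℝ → ℝ → ℝ := fun x y =>
  pdx (g11 P Q R S) x y - R x y * g10 P Q R S x y + P x y * g21 P Q R S x y - al1 P Q R S x y * b1 P Q R S x y - 4 * al0 P Q R S x y * b2 P Q R S x y

def d21 (P Q R S : ℝ → ℝ → ℝ) : ℝ → ℝ → ℝ := fun x y =>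
  pdx (g21 P Q R S) x y - R x y * (g20 P Q R S x y + g11 P Q R S x y) + 2 * Q x y * g21 P Q R S x y - 5 * al1 P Q R S x y * b2 P Q R S x y

def d31 (P Q R S : ℝ → ℝ → ℝ) : ℝ → ℝ → ℝ := fun x y =>
  pdy (g21 P Q R S) x y - S x y * (g20 P Q R S x y + g11 P Q R S x y) + 2 * R x y * g21 P Q R S x y - 5 * al2 P Q R S x y * b2 P Q R S x y

def J1 (P Q R S : ℝ → ℝ → ℝ) : ℝ → ℝ → ℝ := fun x y =>
  b2 P Q R S x y * (d20 P Q R S x y - d11 P Q R S x y) + b1 P Q R S x y * (d21 P Q R S x y - d30 P Q R S x y) + (7 / 5) * (g20 P Q R S x y - g11 P Q R S x y) ^ 2 + (3 / 5) * (g20 P Q R S x y * g11 P Q R S x y - g10 P Q R S x y * g21 P Q R S x y)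

def J2 (P Q R S : ℝ → ℝ → ℝ) : ℝ → ℝ → ℝ := fun x y =>
  Gam1 P Q R S x y * (d20 P Q R S x y - d11 P Q R S x y) + Gam0 P Q R S x y * (d21 P Q R S x y - d30 P Q R S x y) + 3 * (g20 P Q R S x y - g11 P Q R S x y) * (g10 P Q R S x y * g21 P Q R S x y - g20 P Q R S x y * g11 P Q R S x y) + (4 / 3) * (g20 P Q R S x y - g11 P Q R S x y) ^ 3

def J3 (P Q R S : ℝ → ℝ → ℝ) : ℝ → ℝ → ℝ := fun x y =>
  b2 P Q R S x y ^ 3 * d10 P Q R S x y - b1 P Q R S x y * b2 P Q R S x y ^ 2 * (2 * d20 P Q R S x y + d11 P Q R S x y) + b1 P Q R S x y ^ 2 * b2 P Q R S x y * (d30 P Q R S x y + 2 * d21 P Q R S x y) - b1 P Q R S x y ^ 3 * d31 P Q R S x y + 4 * (g20 P Q R S x y - g11 P Q R S x y) * J0 P Q R S x y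

def J4 (P Q R S : ℝ → ℝ → ℝ) : ℝ → ℝ → ℝ := fun x y =>
  -b2 P Q R S x y * (b2 P Q R S x y * Gam0 P Q R S x y + 2 * b1 P Q R S x y * Gam1 P Q R S x y) * (2 * d20 P Q R S x y + d11 P Q R S x y) + b1 P Q R S x y * (2 * b2 P Q R S x y * Gam0 P Q R S x y + b1 P Q R S x y * Gam1 P Q R S x y) * (d30 P Q R S x y + 2 * d21 P Q R S x y) + 3 * b2 P Q R S x y ^ 2 * Gam1 P Q R S x y * d10 P Q R S x y - 3 * b1 P Q R S x y ^ 2 * Gam0 P Q R S x y * d31 P Q R S x y + (66 / 5) * (g20 P Q R S x y - g11 P Q R S x y) ^ 2 * J0 P Q R S x y + (36 / 5) * (g10 P Q R S x y * g21 P Q R S x y - g20 P Q R S x y * g11 P Q R S x y) * J0 P Q R S x y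

def AA (P Q R S : ℝ → ℝ → ℝ) : ℝ → ℝ → ℝ := fun x y =>
  pdy (pdy P) x y - 2 * pdx (pdy Q) x y + pdx (pdx R) x y + 2 * P x y * pdx S x y + S x y * pdx P x y - 3 * P x y * pdy R x y - 3 * R x y * pdy P x y - 3 * Q x y * pdx R x y + 6 * Q x y * pdy Q x y

def BB (P Q R S : ℝ → ℝ → ℝ) : ℝ → ℝ → ℝ := fun x y =>
  pdx (pdx S) x y - 2 * pdx (pdy R) x y + pdy (pdy Q) x y - 2 * S x y * pdy P x y - P x y * pdy S x y + 3 * S x y * pdx Q x y + 3 * Q x y * pdx S x y + 3 * R x y * pdy Q x y - 6 * R x y * pdx R x y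

def GG (P Q R S : ℝ → ℝ → ℝ) : ℝ → ℝ → ℝ := fun x y =>
  -BB P Q R S x y * pdx (BB P Q R S) x y - 3 * AA P Q R S x y * pdy (BB P Q R S) x y + 4 * BB P Q R S x y * pdy (AA P Q R S) x y + 3 * S x y * AA P Q R S x y ^ 2 - 6 * R x y * AA P Q R S x y * BB P Q R S x y + 3 * Q x y * BB P Q R S x y ^ 2

def HH (P Q R S : ℝ → ℝ → ℝ) : ℝ → ℝ → ℝ := fun x y =>
  -AA P Q R S x y * pdy (AA P Q R S) x y - 3 * BB P Q R S x y * pdx (AA P Q R S) x y + 4 * AA P Q R S x y * pdx (BB P Q R S) x y - 3 * P x y * BB P Q R S x y ^ 2 + 6 * Q x y * AA P Q R S x y * BB P Q R S x y - 3 * R x y * AA P Q R S x y ^ 2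

def Phi (P Q R S : ℝ → ℝ → ℝ) : ℝ → ℝ → ℝ := fun x y =>
  AA P Q R S x y * BB P Q R S x y * pdy (AA P Q R S) x y + AA P Q R S x y * BB P Q R S x y * pdx (BB P Q R S) x y - AA P Q R S x y ^ 2 * pdy (BB P Q R S) x y - BB P Q R S x y ^ 2 * pdx (AA P Q R S) x y - P x y * BB P Q R S x y ^ 3 + 3 * Q x y * AA P Q R S x y * BB P Q R S x y ^ 2 - 3 * R x y * AA P Q R S x y ^ 2 * BB P Q R S x y + S x y * AA P Q R S x y ^ 3

def I3v (P Q R S F : ℝ → ℝ → ℝ) : ℝ → ℝ → ℝ := fun x y =>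
  BB P Q R S x y * (HH P Q R S x y * pdx (GG P Q R S) x y - GG P Q R S x y * pdx (HH P Q R S) x y) / (3 * F x y ^ 9) - AA P Q R S x y * (HH P Q R S x y * pdy (GG P Q R S) x y - GG P Q R S x y * pdy (HH P Q R S) x y) / (3 * F x y ^ 9) + (HH P Q R S x y * pdy F x y + GG P Q R S x y * pdx F x y) / (3 * F x y ^ 5) + BB P Q R S x y * GG P Q R S x y ^ 2 * P x y / (3 * F x y ^ 9) - (AA P Q R S x y * GG P Q R S x y ^ 2 - 2 * HH P Q R S x y * BB P Q R S x y * GG P Q R S x y) * Q x y / (3 * F x y ^ 9) + (BB P Q R S x y * HH P Q R S x y ^ 2 - 2 * HH P Q R S x y * AA P Q R S x y * GG P Q R S x y) * R x y / (3 * F x y ^ 9) - AA P Q R S x y * HH P Q R S x y ^ 2 * S x y / (3 * F x y ^ 9)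

def I6v (P Q R S F : ℝ → ℝ → ℝ) : ℝ → ℝ → ℝ := fun x y =>
  (pdy (AA P Q R S) x y - pdx (BB P Q R S) x y) / (3 * F x y ^ 2) - (AA P Q R S x y * pdy F x y - BB P Q R S x y * pdx F x y) / (3 * F x y ^ 3)

def I7v (P Q R S F : ℝ → ℝ → ℝ) : ℝ → ℝ → ℝ := fun x y =>
  (GG P Q R S x y * HH P Q R S x y * pdx (GG P Q R S) x y - GG P Q R S x y ^ 2 * pdx (HH P Q R S) x y + HH P Q R S x y ^ 2 * pdy (GG P Q R S) x y - HH P Q R S x y * GG P Q R S x y * pdy (HH P Q R S) x y) / (3 * F x y ^ 11) + (GG P Q R S x y ^ 3 * P x y + 3 * GG P Q R S x y ^ 2 * HH P Q R S x y * Q x y + 3 * GG P Q R S x y * HH P Q R S x y ^ 2 * R x y + HH P Q R S x y ^ 3 * S x y) / (3 * F x y ^ 11)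

def I8v (P Q R S F : ℝ → ℝ → ℝ) : ℝ → ℝ → ℝ := fun x y =>
  GG P Q R S x y * (AA P Q R S x y * pdx (GG P Q R S) x y + BB P Q R S x y * pdx (HH P Q R S) x y) / (3 * F x y ^ 9) + HH P Q R S x y * (AA P Q R S x y * pdy (GG P Q R S) x y + BB P Q R S x y * pdy (HH P Q R S) x y) / (3 * F x y ^ 9) - 10 * (HH P Q R S x y * pdy F x y + GG P Q R S x y * pdx F x y) / (3 * F x y ^ 5) - BB P Q R S x y * GG P Q R S x y ^ 2 * P x y / (3 * F x y ^ 9) + (AA P Q R S x y * GG P Q R S x y ^ 2 - 2 * HH P Q R S x y * BB P Q R S x y * GG P Q R S x y) * Q x y / (3 * F x y ^ 9) - (BB P Q R S x y * HH P Q R S x y ^ 2 - 2 * HH P Q R S x y * AA P Q R S x y * GG P Q R S x y) * R x y / (3 * F x y ^ 9) + AA P Q R S x y * HH P Q R S x y ^ 2 * S x y / (3 * F x y ^ 9)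

def XX (P Q R S F f : ℝ → ℝ → ℝ) : ℝ → ℝ → ℝ := fun x y =>
  (BB P Q R S x y * pdx f x y - AA P Q R S x y * pdy f x y) / F x y ^ 2

def YY (P Q R S F f : ℝ → ℝ → ℝ) : ℝ → ℝ → ℝ := fun x y =>
  (GG P Q R S x y * pdx f x y + HH P Q R S x y * pdy f x y) / F x y ^ 4

def IBgd1 (P Q R S F : ℝ → ℝ → ℝ) : ℝ → ℝ → ℝ := fun x y =>
  J1 P Q R S x y / F x y ^ 4

def IBgd2 (P Q R S F : ℝ → ℝ → ℝ) : ℝ → ℝ → ℝ := fun x y =>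
  J2 P Q R S x y / F x y ^ 6

def IBgd3 (P Q R S F : ℝ → ℝ → ℝ) : ℝ → ℝ → ℝ := fun x y =>
  -(J3 P Q R S x y / F x y ^ 7)

def IBgd4 (P Q R S F : ℝ → ℝ → ℝ) : ℝ → ℝ → ℝ := fun x y =>
  -(J4 P Q R S x y / F x y ^ 9)



/-- Smoothness of a function of two real variables. -/
def IsSmooth (f : ℝ → ℝ → ℝ) : Prop := ContDiff ℝ (⊤ : ℕ∞) (uncurry f)

namespace IsSmooth

variable {f g : ℝ → ℝ → ℝ}

@[simp] lemma add (hf : IsSmooth f) (hg : IsSmooth g) : IsSmooth (f + g) := ContDiff.add hf hg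

@[simp] lemma sub (hf : IsSmooth f) (hg : IsSmooth g) : IsSmooth (f - g) := ContDiff.sub hf hg

@[simp] lemma mul (hf : IsSmooth f) (hg : IsSmooth g) : IsSmooth (f * g) := ContDiff.mul hf hg

@[simp] lemma pow (hf : IsSmooth f) (n : ℕ) : IsSmooth (f ^ n) := ContDiff.pow hf n

@[simp] lemma ofNat (n : ℕ) [n.AtLeastTwo] : IsSmooth (ofNat(n) : ℝ → ℝ → ℝ) :=
  contDiff_const (c := (ofNat(n) : ℝ))

lemma differentiable (hf : IsSmooth f) : Differentiable ℝ (uncurry f) :=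
  ContDiff.differentiable hf (by simp)

lemma hasDerivAt_fst (hf : IsSmooth f) (x y : ℝ) :
    HasDerivAt (fun t => f t y) (fderiv ℝ (uncurry f) (x, y) (1, 0)) x :=
  (hf.differentiable (x, y)).hasFDerivAt.comp_hasDerivAt (f := fun t => (t, y)) x
    ((hasDerivAt_id x).prodMk (hasDerivAt_const x y))

lemma hasDerivAt_snd (hf : IsSmooth f) (x y : ℝ) :
    HasDerivAt (fun t => f x t) (fderiv ℝ (uncurry f) (x, y) (0, 1)) y :=
  (hf.differentiable (x, y)).hasFDerivAt.comp_hasDerivAt (f := fun t => (x, t)) y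
    ((hasDerivAt_const y x).prodMk (hasDerivAt_id y))

lemma pdx_eq (hf : IsSmooth f) (x y : ℝ) :
    pdx f x y = fderiv ℝ (uncurry f) (x, y) (1, 0) := (hf.hasDerivAt_fst x y).deriv

lemma pdy_eq (hf : IsSmooth f) (x y : ℝ) :
    pdy f x y = fderiv ℝ (uncurry f) (x, y) (0, 1) := (hf.hasDerivAt_snd x y).deriv

lemma hasDerivAt_pdx (hf : IsSmooth f) (x y : ℝ) :
    HasDerivAt (fun t => f t y) (pdx f x y) x := by
  rw [hf.pdx_eq]; exact hf.hasDerivAt_fst x y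

lemma hasDerivAt_pdy (hf : IsSmooth f) (x y : ℝ) :
    HasDerivAt (fun t => f x t) (pdy f x y) y := by
  rw [hf.pdy_eq]; exact hf.hasDerivAt_snd x y

lemma contDiff_fderiv (hf : IsSmooth f) : ContDiff ℝ (⊤ : ℕ∞) (fderiv ℝ (uncurry f)) :=
  ContDiff.fderiv_right (n := (⊤ : ℕ∞)) hf (by simp)

lemma uncurry_pdx (hf : IsSmooth f) :
    uncurry (pdx f) = fun p => fderiv ℝ (uncurry f) p (1, 0) :=
  funext fun p => hf.pdx_eq p.1 p.2

lemma uncurry_pdy (hf : IsSmooth f) :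
    uncurry (pdy f) = fun p => fderiv ℝ (uncurry f) p (0, 1) :=
  funext fun p => hf.pdy_eq p.1 p.2

@[simp] protected lemma pdx (hf : IsSmooth f) : IsSmooth (pdx f) := by
  unfold IsSmooth
  rw [hf.uncurry_pdx]
  exact hf.contDiff_fderiv.clm_apply contDiff_const

@[simp] protected lemma pdy (hf : IsSmooth f) : IsSmooth (pdy f) := by
  unfold IsSmooth
  rw [hf.uncurry_pdy]
  exact hf.contDiff_fderiv.clm_apply contDiff_const

lemma pdy_pdx (hf : IsSmooth f) : pdy (pdx f) = pdx (pdy f) := by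
  funext x y
  have hd : DifferentiableAt ℝ (fderiv ℝ (uncurry f)) (x, y) :=
    (hf.contDiff_fderiv.differentiable (by simp)) (x, y)
  rw [hf.pdx.pdy_eq, hf.pdy.pdx_eq, hf.uncurry_pdx, hf.uncurry_pdy,
    fderiv_clm_apply hd (differentiableAt_const _),
    fderiv_clm_apply hd (differentiableAt_const _)]
  have hs : IsSymmSndFDerivAt ℝ (uncurry f) (x, y) :=
    ContDiffAt.isSymmSndFDerivAt (n := (⊤ : ℕ∞)) (ContDiff.contDiffAt hf)
      (by simpa using WithTop.coe_le_coe.2 (le_top (a := (2 : ℕ∞))))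
  simpa using hs (0, 1) (1, 0)

@[simp] lemma pdx_add (hf : IsSmooth f) (hg : IsSmooth g) : pdx (f + g) = pdx f + pdx g :=
  funext₂ fun x y => ((hf.hasDerivAt_pdx x y).add (hg.hasDerivAt_pdx x y)).deriv

@[simp] lemma pdy_add (hf : IsSmooth f) (hg : IsSmooth g) : pdy (f + g) = pdy f + pdy g :=
  funext₂ fun x y => ((hf.hasDerivAt_pdy x y).add (hg.hasDerivAt_pdy x y)).deriv

@[simp] lemma pdx_sub (hf : IsSmooth f) (hg : IsSmooth g) : pdx (f - g) = pdx f - pdx g :=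
  funext₂ fun x y => ((hf.hasDerivAt_pdx x y).sub (hg.hasDerivAt_pdx x y)).deriv

@[simp] lemma pdy_sub (hf : IsSmooth f) (hg : IsSmooth g) : pdy (f - g) = pdy f - pdy g :=
  funext₂ fun x y => ((hf.hasDerivAt_pdy x y).sub (hg.hasDerivAt_pdy x y)).deriv

@[simp] lemma pdx_mul (hf : IsSmooth f) (hg : IsSmooth g) : pdx (f * g) = pdx f * g + f * pdx g :=
  funext₂ fun x y => ((hf.hasDerivAt_pdx x y).mul (hg.hasDerivAt_pdx x y)).deriv

@[simp] lemma pdy_mul (hf : IsSmooth f) (hg : IsSmooth g) : pdy (f * g) = pdy f * g + f * pdy g :=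
  funext₂ fun x y => ((hf.hasDerivAt_pdy x y).mul (hg.hasDerivAt_pdy x y)).deriv

@[simp] lemma pdx_pow (hf : IsSmooth f) (n : ℕ) :
    pdx (f ^ n) = fun x y => n * f x y ^ (n - 1) * pdx f x y :=
  funext₂ fun x y => ((hf.hasDerivAt_pdx x y).pow n).deriv

@[simp] lemma pdy_pow (hf : IsSmooth f) (n : ℕ) :
    pdy (f ^ n) = fun x y => n * f x y ^ (n - 1) * pdy f x y :=
  funext₂ fun x y => ((hf.hasDerivAt_pdy x y).pow n).deriv

end IsSmooth

@[simp] lemma pdx_ofNat (n : ℕ) [n.AtLeastTwo] : pdx (ofNat(n) : ℝ → ℝ → ℝ) = 0 :=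
  funext₂ fun x _ => (hasDerivAt_const x (ofNat(n) : ℝ)).deriv

@[simp] lemma pdy_ofNat (n : ℕ) [n.AtLeastTwo] : pdy (ofNat(n) : ℝ → ℝ → ℝ) = 0 :=
  funext₂ fun _ y => (hasDerivAt_const y (ofNat(n) : ℝ)).deriv

lemma pdx_neg (f : ℝ → ℝ → ℝ) (x y : ℝ) : pdx (fun x y => -f x y) x y = -pdx f x y := by
  simp [pdx]

lemma pdy_neg (f : ℝ → ℝ → ℝ) (x y : ℝ) : pdy (fun x y => -f x y) x y = -pdy f x y := by
  simp [pdy]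

section Structure

variable {P Q R S : ℝ → ℝ → ℝ}

lemma al0_eq : al0 P Q R S = pdx Q - pdy P + 2 * P * R - 2 * Q ^ 2 := rfl

lemma al1_eq : al1 P Q R S = pdx R - pdy Q + P * S - Q * R := rfl

lemma al2_eq : al2 P Q R S = pdx S - pdy R + 2 * Q * S - 2 * R ^ 2 := rfl

lemma b1_eq : b1 P Q R S = pdx (al1 P Q R S) - pdy (al0 P Q R S) + R * al0 P Q R S
    - 2 * Q * al1 P Q R S + P * al2 P Q R S := rfl

lemma b2_eq : b2 P Q R S = pdx (al2 P Q R S) - pdy (al1 P Q R S) + S * al0 P Q R S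
    - 2 * R * al1 P Q R S + Q * al2 P Q R S := rfl

lemma g10_eq : g10 P Q R S = pdx (b1 P Q R S) - Q * b1 P Q R S + P * b2 P Q R S := rfl

lemma g11_eq : g11 P Q R S = pdx (b2 P Q R S) - R * b1 P Q R S + Q * b2 P Q R S := rfl

lemma g20_eq : g20 P Q R S = pdy (b1 P Q R S) - R * b1 P Q R S + Q * b2 P Q R S := rfl

lemma g21_eq : g21 P Q R S = pdy (b2 P Q R S) - S * b1 P Q R S + R * b2 P Q R S := rfl

lemma J0_eq : J0 P Q R S = b2 P Q R S ^ 2 * g10 P Q R S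
    - b1 P Q R S * b2 P Q R S * (g20 P Q R S + g11 P Q R S)
    + b1 P Q R S ^ 2 * g21 P Q R S := rfl

lemma Gam0_eq : Gam0 P Q R S = 3 * b2 P Q R S * g10 P Q R S
    + b1 P Q R S * (g20 P Q R S - 4 * g11 P Q R S) := rfl

lemma Gam1_eq : Gam1 P Q R S = b2 P Q R S * (4 * g20 P Q R S - g11 P Q R S)
    - 3 * b1 P Q R S * g21 P Q R S := rfl

lemma isSmooth_al0 (hP : IsSmooth P) (hQ : IsSmooth Q) (hR : IsSmooth R) :
    IsSmooth (al0 P Q R S) := by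
  simp (maxDischargeDepth := 8) [al0_eq, hP, hQ, hR]

lemma isSmooth_al1 (hP : IsSmooth P) (hQ : IsSmooth Q) (hR : IsSmooth R) (hS : IsSmooth S) :
    IsSmooth (al1 P Q R S) := by
  simp (maxDischargeDepth := 8) [al1_eq, hP, hQ, hR, hS]

lemma isSmooth_al2 (hQ : IsSmooth Q) (hR : IsSmooth R) (hS : IsSmooth S) :
    IsSmooth (al2 P Q R S) := by
  simp (maxDischargeDepth := 8) [al2_eq, hQ, hR, hS]

lemma isSmooth_b1 (hP : IsSmooth P) (hQ : IsSmooth Q) (hR : IsSmooth R) (hS : IsSmooth S) :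
    IsSmooth (b1 P Q R S) := by
  simp (maxDischargeDepth := 8) [b1_eq, hP, hQ, hR, isSmooth_al0 hP hQ hR,
    isSmooth_al1 hP hQ hR hS, isSmooth_al2 hQ hR hS]

lemma isSmooth_b2 (hP : IsSmooth P) (hQ : IsSmooth Q) (hR : IsSmooth R) (hS : IsSmooth S) :
    IsSmooth (b2 P Q R S) := by
  simp (maxDischargeDepth := 8) [b2_eq, hQ, hR, hS, isSmooth_al0 hP hQ hR,
    isSmooth_al1 hP hQ hR hS, isSmooth_al2 hQ hR hS]

lemma isSmooth_g10 (hP : IsSmooth P) (hQ : IsSmooth Q) (hR : IsSmooth R) (hS : IsSmooth S) :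
    IsSmooth (g10 P Q R S) := by
  simp (maxDischargeDepth := 8) [g10_eq, hP, hQ, isSmooth_b1 hP hQ hR hS, isSmooth_b2 hP hQ hR hS]

lemma isSmooth_g11 (hP : IsSmooth P) (hQ : IsSmooth Q) (hR : IsSmooth R) (hS : IsSmooth S) :
    IsSmooth (g11 P Q R S) := by
  simp (maxDischargeDepth := 8) [g11_eq, hQ, hR, isSmooth_b1 hP hQ hR hS, isSmooth_b2 hP hQ hR hS]

lemma isSmooth_g20 (hP : IsSmooth P) (hQ : IsSmooth Q) (hR : IsSmooth R) (hS : IsSmooth S) :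
    IsSmooth (g20 P Q R S) := by
  simp (maxDischargeDepth := 8) [g20_eq, hQ, hR, isSmooth_b1 hP hQ hR hS, isSmooth_b2 hP hQ hR hS]

lemma isSmooth_g21 (hP : IsSmooth P) (hQ : IsSmooth Q) (hR : IsSmooth R) (hS : IsSmooth S) :
    IsSmooth (g21 P Q R S) := by
  simp (maxDischargeDepth := 8) [g21_eq, hR, hS, isSmooth_b1 hP hQ hR hS, isSmooth_b2 hP hQ hR hS]

lemma b1_eq_AA (hP : IsSmooth P) (hQ : IsSmooth Q) (hR : IsSmooth R) (hS : IsSmooth S) :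
    b1 P Q R S = AA P Q R S := by
  funext x y
  simp (maxDischargeDepth := 8) [b1_eq, al0_eq, al1_eq, al2_eq, AA, IsSmooth.pdy_pdx, hP, hQ, hR,
    hS]
  ring

lemma b2_eq_BB (hP : IsSmooth P) (hQ : IsSmooth Q) (hR : IsSmooth R) (hS : IsSmooth S) :
    b2 P Q R S = BB P Q R S := by
  funext x y
  simp (maxDischargeDepth := 8) [b2_eq, al0_eq, al1_eq, al2_eq, BB, IsSmooth.pdy_pdx, hP, hQ, hR,
    hS]
  ring

lemma pdx_J0 (hP : IsSmooth P) (hQ : IsSmooth Q) (hR : IsSmooth R) (hS : IsSmooth S) (x y : ℝ) :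
    pdx (J0 P Q R S) x y =
      2 * b2 P Q R S x y * pdx (b2 P Q R S) x y * g10 P Q R S x y
      + b2 P Q R S x y ^ 2 * pdx (g10 P Q R S) x y
      - (pdx (b1 P Q R S) x y * b2 P Q R S x y + b1 P Q R S x y * pdx (b2 P Q R S) x y)
        * (g20 P Q R S x y + g11 P Q R S x y)
      - b1 P Q R S x y * b2 P Q R S x y * (pdx (g20 P Q R S) x y + pdx (g11 P Q R S) x y)
      + 2 * b1 P Q R S x y * pdx (b1 P Q R S) x y * g21 P Q R S x y
      + b1 P Q R S x y ^ 2 * pdx (g21 P Q R S) x y := by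
  simp (maxDischargeDepth := 8) [J0_eq, isSmooth_b1 hP hQ hR hS, isSmooth_b2 hP hQ hR hS,
    isSmooth_g10 hP hQ hR hS, isSmooth_g11 hP hQ hR hS, isSmooth_g20 hP hQ hR hS,
    isSmooth_g21 hP hQ hR hS]
  ring

lemma pdx_Gam0 (hP : IsSmooth P) (hQ : IsSmooth Q) (hR : IsSmooth R) (hS : IsSmooth S) (x y : ℝ) :
    pdx (Gam0 P Q R S) x y =
      3 * (pdx (b2 P Q R S) x y * g10 P Q R S x y + b2 P Q R S x y * pdx (g10 P Q R S) x y)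
      + pdx (b1 P Q R S) x y * (g20 P Q R S x y - 4 * g11 P Q R S x y)
      + b1 P Q R S x y * (pdx (g20 P Q R S) x y - 4 * pdx (g11 P Q R S) x y) := by
  simp (maxDischargeDepth := 8) [Gam0_eq, isSmooth_b1 hP hQ hR hS, isSmooth_b2 hP hQ hR hS,
    isSmooth_g10 hP hQ hR hS, isSmooth_g11 hP hQ hR hS, isSmooth_g20 hP hQ hR hS]
  ring

lemma pdx_Gam1 (hP : IsSmooth P) (hQ : IsSmooth Q) (hR : IsSmooth R) (hS : IsSmooth S) (x y : ℝ) :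
    pdx (Gam1 P Q R S) x y =
      pdx (b2 P Q R S) x y * (4 * g20 P Q R S x y - g11 P Q R S x y)
      + b2 P Q R S x y * (4 * pdx (g20 P Q R S) x y - pdx (g11 P Q R S) x y)
      - 3 * (pdx (b1 P Q R S) x y * g21 P Q R S x y + b1 P Q R S x y * pdx (g21 P Q R S) x y) := by
  simp (maxDischargeDepth := 8) [Gam1_eq, isSmooth_b1 hP hQ hR hS, isSmooth_b2 hP hQ hR hS,
    isSmooth_g11 hP hQ hR hS, isSmooth_g20 hP hQ hR hS, isSmooth_g21 hP hQ hR hS]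
  ring

lemma pdy_J0 (hP : IsSmooth P) (hQ : IsSmooth Q) (hR : IsSmooth R) (hS : IsSmooth S) (x y : ℝ) :
    pdy (J0 P Q R S) x y =
      2 * b2 P Q R S x y * pdy (b2 P Q R S) x y * g10 P Q R S x y
      + b2 P Q R S x y ^ 2 * pdy (g10 P Q R S) x y
      - (pdy (b1 P Q R S) x y * b2 P Q R S x y + b1 P Q R S x y * pdy (b2 P Q R S) x y)
        * (g20 P Q R S x y + g11 P Q R S x y)
      - b1 P Q R S x y * b2 P Q R S x y * (pdy (g20 P Q R S) x y + pdy (g11 P Q R S) x y)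
      + 2 * b1 P Q R S x y * pdy (b1 P Q R S) x y * g21 P Q R S x y
      + b1 P Q R S x y ^ 2 * pdy (g21 P Q R S) x y := by
  simp (maxDischargeDepth := 8) [J0_eq, isSmooth_b1 hP hQ hR hS, isSmooth_b2 hP hQ hR hS,
    isSmooth_g10 hP hQ hR hS, isSmooth_g11 hP hQ hR hS, isSmooth_g20 hP hQ hR hS,
    isSmooth_g21 hP hQ hR hS]
  ring

lemma pdy_Gam0 (hP : IsSmooth P) (hQ : IsSmooth Q) (hR : IsSmooth R) (hS : IsSmooth S) (x y : ℝ) :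
    pdy (Gam0 P Q R S) x y =
      3 * (pdy (b2 P Q R S) x y * g10 P Q R S x y + b2 P Q R S x y * pdy (g10 P Q R S) x y)
      + pdy (b1 P Q R S) x y * (g20 P Q R S x y - 4 * g11 P Q R S x y)
      + b1 P Q R S x y * (pdy (g20 P Q R S) x y - 4 * pdy (g11 P Q R S) x y) := by
  simp (maxDischargeDepth := 8) [Gam0_eq, isSmooth_b1 hP hQ hR hS, isSmooth_b2 hP hQ hR hS,
    isSmooth_g10 hP hQ hR hS, isSmooth_g11 hP hQ hR hS, isSmooth_g20 hP hQ hR hS]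
  ring

lemma pdy_Gam1 (hP : IsSmooth P) (hQ : IsSmooth Q) (hR : IsSmooth R) (hS : IsSmooth S) (x y : ℝ) :
    pdy (Gam1 P Q R S) x y =
      pdy (b2 P Q R S) x y * (4 * g20 P Q R S x y - g11 P Q R S x y)
      + b2 P Q R S x y * (4 * pdy (g20 P Q R S) x y - pdy (g11 P Q R S) x y)
      - 3 * (pdy (b1 P Q R S) x y * g21 P Q R S x y + b1 P Q R S x y * pdy (g21 P Q R S) x y) := by
  simp (maxDischargeDepth := 8) [Gam1_eq, isSmooth_b1 hP hQ hR hS, isSmooth_b2 hP hQ hR hS,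
    isSmooth_g11 hP hQ hR hS, isSmooth_g20 hP hQ hR hS, isSmooth_g21 hP hQ hR hS]
  ring

lemma pdy_g10 (hP : IsSmooth P) (hQ : IsSmooth Q) (hR : IsSmooth R) (hS : IsSmooth S) (x y : ℝ) :
    pdy (g10 P Q R S) x y =
      pdx (g20 P Q R S) x y + al1 P Q R S x y * b1 P Q R S x y - al0 P Q R S x y * b2 P Q R S x y
      - Q x y * pdy (b1 P Q R S) x y + P x y * pdy (b2 P Q R S) x y
      + R x y * pdx (b1 P Q R S) x y - Q x y * pdx (b2 P Q R S) x y
      - (P x y * S x y - Q x y * R x y) * b1 P Q R S x y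
      + (2 * P x y * R x y - 2 * Q x y ^ 2) * b2 P Q R S x y := by
  simp (maxDischargeDepth := 8) [g10_eq, g20_eq, al0, al1, IsSmooth.pdy_pdx, hP, hQ, hR,
    isSmooth_b1 hP hQ hR hS, isSmooth_b2 hP hQ hR hS]
  ring

lemma pdy_g11 (hP : IsSmooth P) (hQ : IsSmooth Q) (hR : IsSmooth R) (hS : IsSmooth S) (x y : ℝ) :
    pdy (g11 P Q R S) x y =
      pdx (g21 P Q R S) x y + al2 P Q R S x y * b1 P Q R S x y - al1 P Q R S x y * b2 P Q R S x y
      - R x y * pdy (b1 P Q R S) x y + Q x y * pdy (b2 P Q R S) x y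
      + S x y * pdx (b1 P Q R S) x y - R x y * pdx (b2 P Q R S) x y
      - (2 * Q x y * S x y - 2 * R x y ^ 2) * b1 P Q R S x y
      + (P x y * S x y - Q x y * R x y) * b2 P Q R S x y := by
  simp (maxDischargeDepth := 8) [g11_eq, g21_eq, al1, al2, IsSmooth.pdy_pdx, hQ, hR, hS,
    isSmooth_b1 hP hQ hR hS, isSmooth_b2 hP hQ hR hS]
  ring

lemma GG_eq_Gam1 (hP : IsSmooth P) (hQ : IsSmooth Q) (hR : IsSmooth R) (hS : IsSmooth S) :
    GG P Q R S = Gam1 P Q R S := by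
  funext x y
  simp only [GG, Gam1, g11, g20, g21, ← b1_eq_AA hP hQ hR hS, ← b2_eq_BB hP hQ hR hS]
  ring

lemma HH_eq_neg_Gam0 (hP : IsSmooth P) (hQ : IsSmooth Q) (hR : IsSmooth R) (hS : IsSmooth S) :
    HH P Q R S = fun x y => -Gam0 P Q R S x y := by
  funext x y
  simp only [HH, Gam0, g10, g11, g20, ← b1_eq_AA hP hQ hR hS, ← b2_eq_BB hP hQ hR hS]
  ring

lemma Phi_eq_neg_J0 (hP : IsSmooth P) (hQ : IsSmooth Q) (hR : IsSmooth R) (hS : IsSmooth S) :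
    Phi P Q R S = fun x y => -J0 P Q R S x y := by
  funext x y
  simp only [Phi, J0, g10, g11, g20, g21, ← b1_eq_AA hP hQ hR hS, ← b2_eq_BB hP hQ hR hS]
  ring

end Structure

section Relations

variable (P Q R S : ℝ → ℝ → ℝ) (x y : ℝ)

lemma pdx_b1_eq :
    pdx (b1 P Q R S) x y =
      g10 P Q R S x y + Q x y * b1 P Q R S x y - P x y * b2 P Q R S x y := by
  rw [g10]
  ring

lemma pdx_b2_eq :
    pdx (b2 P Q R S) x y =
      g11 P Q R S x y + R x y * b1 P Q R S x y - Q x y * b2 P Q R S x y := by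
  rw [g11]
  ring

lemma pdy_b1_eq :
    pdy (b1 P Q R S) x y =
      g20 P Q R S x y + R x y * b1 P Q R S x y - Q x y * b2 P Q R S x y := by
  rw [g20]
  ring

lemma pdy_b2_eq :
    pdy (b2 P Q R S) x y =
      g21 P Q R S x y + S x y * b1 P Q R S x y - R x y * b2 P Q R S x y := by
  rw [g21]
  ring

lemma pdx_g10_eq :
    pdx (g10 P Q R S) x y =
      d10 P Q R S x y + 2 * Q x y * g10 P Q R S x y
      - P x y * (g20 P Q R S x y + g11 P Q R S x y) + 5 * al0 P Q R S x y * b1 P Q R S x y := by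
  rw [d10]
  ring

lemma pdx_g20_eq :
    pdx (g20 P Q R S) x y =
      d20 P Q R S x y + R x y * g10 P Q R S x y - P x y * g21 P Q R S x y
      + 4 * al1 P Q R S x y * b1 P Q R S x y + al0 P Q R S x y * b2 P Q R S x y := by
  rw [d20]
  ring

lemma pdy_g20_eq :
    pdy (g20 P Q R S) x y =
      d30 P Q R S x y + S x y * g10 P Q R S x y - Q x y * g21 P Q R S x y
      + 4 * al2 P Q R S x y * b1 P Q R S x y + al1 P Q R S x y * b2 P Q R S x y := by
  rw [d30]
  ring

lemma pdx_g11_eq :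
    pdx (g11 P Q R S) x y =
      d11 P Q R S x y + R x y * g10 P Q R S x y - P x y * g21 P Q R S x y
      + al1 P Q R S x y * b1 P Q R S x y + 4 * al0 P Q R S x y * b2 P Q R S x y := by
  rw [d11]
  ring

lemma pdx_g21_eq :
    pdx (g21 P Q R S) x y =
      d21 P Q R S x y + R x y * (g20 P Q R S x y + g11 P Q R S x y)
      - 2 * Q x y * g21 P Q R S x y + 5 * al1 P Q R S x y * b2 P Q R S x y := by
  rw [d21]
  ring

lemma pdy_g21_eq :
    pdy (g21 P Q R S) x y =
      d31 P Q R S x y + S x y * (g20 P Q R S x y + g11 P Q R S x y)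
      - 2 * R x y * g21 P Q R S x y + 5 * al2 P Q R S x y * b2 P Q R S x y := by
  rw [d31]
  ring

end Relations

lemma IsSmooth.pdx_pow_five {f : ℝ → ℝ → ℝ} (hf : IsSmooth f) (x y : ℝ) :
    pdx (fun x y => f x y ^ 5) x y = 5 * f x y ^ 4 * pdx f x y := by
  change pdx (f ^ 5) x y = _
  simp [hf.pdx_pow]

lemma IsSmooth.pdy_pow_five {f : ℝ → ℝ → ℝ} (hf : IsSmooth f) (x y : ℝ) :
    pdy (fun x y => f x y ^ 5) x y = 5 * f x y ^ 4 * pdy f x y := by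
  change pdy (f ^ 5) x y = _
  simp [hf.pdy_pow]

theorem stmt10 (P Q R S : ℝ → ℝ → ℝ)
    (hP : ContDiff ℝ (⊤ : ℕ∞) (uncurry P)) (hQ : ContDiff ℝ (⊤ : ℕ∞) (uncurry Q))
    (hR : ContDiff ℝ (⊤ : ℕ∞) (uncurry R)) (hS : ContDiff ℝ (⊤ : ℕ∞) (uncurry S)) (F : ℝ → ℝ → ℝ)
    (hF : ContDiff ℝ (⊤ : ℕ∞) (uncurry F)) (hF5 : ∀ x y : ℝ, F x y ^ 5 = Phi P Q R S x y) (hFne : ∀ x y : ℝ, F x y ≠ 0) :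
    ∀ x y : ℝ,
      J3 P Q R S x y = -15 * I6v P Q R S F x y * F x y ^ 7 ∧
      J1 P Q R S x y = (I3v P Q R S F x y + (14 / 5) * I8v P Q R S F x y) * F x y ^ 4 ∧
      J4 P Q R S x y = -(3 * I3v P Q R S F x y + (87 / 5) * I8v P Q R S F x y) * F x y ^ 9 := by
  intro x y
  change IsSmooth P at hP
  change IsSmooth Q at hQ
  change IsSmooth R at hR
  change IsSmooth S at hS
  change IsSmooth F at hF
  have hpow : (fun x y => F x y ^ 5) = fun x y => -J0 P Q R S x y := by
    rw [← Phi_eq_neg_J0 hP hQ hR hS]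
    exact funext₂ hF5
  have h0 : F x y ^ 5 = -J0 P Q R S x y := congr_fun₂ hpow x y
  have hx : 5 * F x y ^ 4 * pdx F x y = -pdx (J0 P Q R S) x y := by
    rw [← hF.pdx_pow_five, hpow, pdx_neg]
  have hy : 5 * F x y ^ 4 * pdy F x y = -pdy (J0 P Q R S) x y := by
    rw [← hF.pdy_pow_five, hpow, pdy_neg]
  rw [pdx_J0 hP hQ hR hS] at hx
  rw [pdy_J0 hP hQ hR hS] at hy
  simp only [I3v, I6v, I8v, GG_eq_Gam1 hP hQ hR hS, HH_eq_neg_Gam0 hP hQ hR hS,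
    ← b1_eq_AA hP hQ hR hS, ← b2_eq_BB hP hQ hR hS, pdx_neg, pdy_neg,
    pdx_Gam0 hP hQ hR hS, pdx_Gam1 hP hQ hR hS, pdy_Gam0 hP hQ hR hS, pdy_Gam1 hP hQ hR hS]
  simp only [pdy_g10 hP hQ hR hS, pdy_g11 hP hQ hR hS] at hx hy ⊢
  simp only [pdx_b1_eq, pdx_b2_eq, pdy_b1_eq, pdy_b2_eq, pdx_g10_eq, pdx_g20_eq, pdy_g20_eq,
    pdx_g11_eq, pdx_g21_eq, pdy_g21_eq] at hx hy ⊢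
  simp only [J0] at h0
  simp only [J1, J3, J4, J0, Gam0, Gam1]
  have hF0 := hFne x y
  generalize P x y = p, Q x y = q, R x y = r, S x y = s at *
  generalize al0 P Q R S x y = α₀, al1 P Q R S x y = α₁, al2 P Q R S x y = α₂ at *
  generalize b1 P Q R S x y = a, b2 P Q R S x y = b at *
  generalize g10 P Q R S x y = γ₁₀, g11 P Q R S x y = γ₁₁, g20 P Q R S x y = γ₂₀,
    g21 P Q R S x y = γ₂₁ at *
  generalize d10 P Q R S x y = δ₁₀, d20 P Q R S x y = δ₂₀, d30 P Q R S x y = δ₃₀,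
    d11 P Q R S x y = δ₁₁, d21 P Q R S x y = δ₂₁, d31 P Q R S x y = δ₃₁ at *
  generalize F x y = f, pdx F x y = fx, pdy F x y = fy at *
  refine ⟨?_, ?_, ?_⟩
  · field_simp
    linear_combination 15 * (γ₂₀ - γ₁₁) * h0 - 3 * a * hy + 3 * b * hx
  · field_simp
    linear_combination
      (15 * (b * (δ₂₀ - δ₁₁) + a * (δ₂₁ - δ₃₀)) + 21 * (γ₂₀ - γ₁₁) ^ 2
        + 9 * (γ₂₀ * γ₁₁ - γ₁₀ * γ₂₁)) * h0
      + 27 * (b * (4 * γ₂₀ - γ₁₁) - 3 * a * γ₂₁) * hx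
      - 27 * (3 * b * γ₁₀ + a * (γ₂₀ - 4 * γ₁₁)) * hy
  · field_simp
    linear_combination 171 * (3 * b * γ₁₀ + a * (γ₂₀ - 4 * γ₁₁)) * hy
      - 171 * (b * (4 * γ₂₀ - γ₁₁) - 3 * a * γ₂₁) * hx
end
end

section
/- Theorem 5.2, formula (5.41): in the case of general position the identity J₂ = (−I₇ − 3·𝐗I₈ + 15·𝐘I₆ + (24·I₈ + 15·I₃)·I₆)·F⁶ holds on all of ℝ², where 𝐗 and 𝐘 are the operators of invariant differentiation; equivalently, Bagderina's invariant I₂^Bgd equals −I₇ − 3𝐗I₈ + 15𝐘I₆ + (24I₈ + 15I₃)I₆. -/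
open Function

noncomputable section

/-- Smoothness of a function of two real variables. -/
def Smooth₂ (f : ℝ → ℝ → ℝ) : Prop := ContDiff ℝ (⊤ : ℕ∞) (uncurry f)

namespace Smooth₂

variable {f g : ℝ → ℝ → ℝ}

theorem const (c : ℝ) : Smooth₂ fun _ _ => c := contDiff_const

theorem add (hf : Smooth₂ f) (hg : Smooth₂ g) : Smooth₂ fun x y => f x y + g x y :=
  ContDiff.add hf hg

theorem sub (hf : Smooth₂ f) (hg : Smooth₂ g) : Smooth₂ fun x y => f x y - g x y :=
  ContDiff.sub hf hg

theorem mul (hf : Smooth₂ f) (hg : Smooth₂ g) : Smooth₂ fun x y => f x y * g x y :=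
  ContDiff.mul hf hg

theorem pow (hf : Smooth₂ f) (n : ℕ) : Smooth₂ fun x y => f x y ^ n :=
  ContDiff.pow hf n

theorem inv (hf : Smooth₂ f) (h : ∀ x y, f x y ≠ 0) : Smooth₂ fun x y => (f x y)⁻¹ :=
  ContDiff.inv hf fun p => h p.1 p.2

theorem differentiable (hf : Smooth₂ f) : Differentiable ℝ (uncurry f) :=
  ContDiff.differentiable hf (by simp)

theorem pdx_eq (hf : Smooth₂ f) (x y : ℝ) :
    pdx f x y = fderiv ℝ (uncurry f) (x, y) (1, 0) :=
  ((hf.differentiable (x, y)).hasFDerivAt.comp_hasDerivAt (f := fun t => (t, y)) x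
    ((hasDerivAt_id x).prodMk (hasDerivAt_const x y))).deriv

theorem pdy_eq (hf : Smooth₂ f) (x y : ℝ) :
    pdy f x y = fderiv ℝ (uncurry f) (x, y) (0, 1) :=
  ((hf.differentiable (x, y)).hasFDerivAt.comp_hasDerivAt (f := fun t => (x, t)) y
    ((hasDerivAt_const y x).prodMk (hasDerivAt_id y))).deriv

theorem fderiv_apply (hf : Smooth₂ f) (v : ℝ × ℝ) :
    ContDiff ℝ (⊤ : ℕ∞) fun p => fderiv ℝ (uncurry f) p v :=
  (ContDiff.fderiv_right hf (m := (⊤ : ℕ∞)) (by simp)).clm_apply contDiff_const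

protected theorem pdx (hf : Smooth₂ f) : Smooth₂ (pdx f) := by
  rw [Smooth₂, show uncurry (_root_.pdx f) = fun p => fderiv ℝ (uncurry f) p (1, 0) from
    funext fun p => hf.pdx_eq p.1 p.2]
  exact hf.fderiv_apply _

protected theorem pdy (hf : Smooth₂ f) : Smooth₂ (pdy f) := by
  rw [Smooth₂, show uncurry (_root_.pdy f) = fun p => fderiv ℝ (uncurry f) p (0, 1) from
    funext fun p => hf.pdy_eq p.1 p.2]
  exact hf.fderiv_apply _

theorem pdy_pdx (hf : Smooth₂ f) : pdy (pdx f) = pdx (pdy f) := by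
  funext x y
  have hd : DifferentiableAt ℝ (fderiv ℝ (uncurry f)) (x, y) :=
    (ContDiff.fderiv_right hf (m := (⊤ : ℕ∞)) (by simp)).differentiable (by simp) _
  have key (v w : ℝ × ℝ) : fderiv ℝ (fun p => fderiv ℝ (uncurry f) p v) (x, y) w =
      fderiv ℝ (fderiv ℝ (uncurry f)) (x, y) w v := by
    rw [fderiv_clm_apply hd (differentiableAt_const v)]
    simp
  rw [hf.pdx.pdy_eq, hf.pdy.pdx_eq,
    show uncurry (_root_.pdx f) = fun p => fderiv ℝ (uncurry f) p (1, 0) from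
      funext fun p => hf.pdx_eq p.1 p.2,
    show uncurry (_root_.pdy f) = fun p => fderiv ℝ (uncurry f) p (0, 1) from
      funext fun p => hf.pdy_eq p.1 p.2, key, key]
  exact (ContDiff.contDiffAt hf).isSymmSndFDerivAt
    (minSmoothness_of_isRCLikeNormedField.trans_le
      (WithTop.coe_le_coe.2 (le_top (a := (2 : ℕ∞))))) _ _

theorem hasDerivAt_x (hf : Smooth₂ f) (x y : ℝ) :
    HasDerivAt (fun t => f t y) (pdx f x y) x := by
  rw [hf.pdx_eq]
  exact (hf.differentiable (x, y)).hasFDerivAt.comp_hasDerivAt (f := fun t => (t, y)) x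
    ((hasDerivAt_id x).prodMk (hasDerivAt_const x y))

theorem hasDerivAt_y (hf : Smooth₂ f) (x y : ℝ) :
    HasDerivAt (fun t => f x t) (pdy f x y) y := by
  rw [hf.pdy_eq]
  exact (hf.differentiable (x, y)).hasFDerivAt.comp_hasDerivAt (f := fun t => (x, t)) y
    ((hasDerivAt_const y x).prodMk (hasDerivAt_id y))

end Smooth₂

/-- The rules of differentiation shared by the two partial derivatives `pdx` and `pdy`. -/
structure IsPartial (D : (ℝ → ℝ → ℝ) → ℝ → ℝ → ℝ) : Prop where
  const (c : ℝ) : D (fun _ _ => c) = fun _ _ => 0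
  add {f g : ℝ → ℝ → ℝ} : Smooth₂ f → Smooth₂ g →
    D (fun x y => f x y + g x y) = fun x y => D f x y + D g x y
  sub {f g : ℝ → ℝ → ℝ} : Smooth₂ f → Smooth₂ g →
    D (fun x y => f x y - g x y) = fun x y => D f x y - D g x y
  mul {f g : ℝ → ℝ → ℝ} : Smooth₂ f → Smooth₂ g →
    D (fun x y => f x y * g x y) = fun x y => D f x y * g x y + f x y * D g x y
  pow {f : ℝ → ℝ → ℝ} (n : ℕ) : Smooth₂ f →
    D (fun x y => f x y ^ n) = fun x y => n * f x y ^ (n - 1) * D f x y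
  inv {f : ℝ → ℝ → ℝ} : Smooth₂ f → (∀ x y, f x y ≠ 0) →
    D (fun x y => (f x y)⁻¹) = fun x y => -D f x y / f x y ^ 2

theorem isPartial_pdx : IsPartial pdx where
  const c := by funext x y; simp [pdx]
  add hf hg := by funext x y; exact ((hf.hasDerivAt_x x y).add (hg.hasDerivAt_x x y)).deriv
  sub hf hg := by funext x y; exact ((hf.hasDerivAt_x x y).sub (hg.hasDerivAt_x x y)).deriv
  mul hf hg := by funext x y; exact ((hf.hasDerivAt_x x y).mul (hg.hasDerivAt_x x y)).deriv
  pow n hf := by funext x y; exact ((hf.hasDerivAt_x x y).pow n).deriv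
  inv hf h := by funext x y; exact ((hf.hasDerivAt_x x y).inv (h x y)).deriv

theorem isPartial_pdy : IsPartial pdy where
  const c := by funext x y; simp [pdy]
  add hf hg := by funext x y; exact ((hf.hasDerivAt_y x y).add (hg.hasDerivAt_y x y)).deriv
  sub hf hg := by funext x y; exact ((hf.hasDerivAt_y x y).sub (hg.hasDerivAt_y x y)).deriv
  mul hf hg := by funext x y; exact ((hf.hasDerivAt_y x y).mul (hg.hasDerivAt_y x y)).deriv
  pow n hf := by funext x y; exact ((hf.hasDerivAt_y x y).pow n).deriv
  inv hf h := by funext x y; exact ((hf.hasDerivAt_y x y).inv (h x y)).deriv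

/-- Smoothness of the four coefficients of the equation. -/
structure SmoothCoeffs (P Q R S : ℝ → ℝ → ℝ) : Prop where
  smooth_P : Smooth₂ P
  smooth_Q : Smooth₂ Q
  smooth_R : Smooth₂ R
  smooth_S : Smooth₂ S

/-- The quadratic covariant of the first-order jet whose product with `Phi` is the value of the
covariant derivative of `(b1, b2)` on the vector field `(GG, HH)`. -/
def kap (P Q R S : ℝ → ℝ → ℝ) : ℝ → ℝ → ℝ := fun x y =>
  -9 * (g10 P Q R S x y * g21 P Q R S x y - g20 P Q R S x y * g11 P Q R S x y)
    - 4 * (g20 P Q R S x y - g11 P Q R S x y) ^ 2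

namespace SmoothCoeffs

variable {P Q R S F : ℝ → ℝ → ℝ} {D : (ℝ → ℝ → ℝ) → ℝ → ℝ → ℝ}

theorem smooth_b1 (h : SmoothCoeffs P Q R S) : Smooth₂ (b1 P Q R S) := by
  unfold b1 al0 al1 al2
  simp (maxDischargeDepth := 30) only [h.smooth_P, h.smooth_Q, h.smooth_R, h.smooth_S,
    Smooth₂.const, Smooth₂.add, Smooth₂.sub, Smooth₂.mul, Smooth₂.pow, Smooth₂.pdx, Smooth₂.pdy]

theorem smooth_b2 (h : SmoothCoeffs P Q R S) : Smooth₂ (b2 P Q R S) := by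
  unfold b2 al0 al1 al2
  simp (maxDischargeDepth := 30) only [h.smooth_P, h.smooth_Q, h.smooth_R, h.smooth_S,
    Smooth₂.const, Smooth₂.add, Smooth₂.sub, Smooth₂.mul, Smooth₂.pow, Smooth₂.pdx, Smooth₂.pdy]

theorem smooth_g10 (h : SmoothCoeffs P Q R S) : Smooth₂ (g10 P Q R S) :=
  (h.smooth_b1.pdx.sub (h.smooth_Q.mul h.smooth_b1)).add (h.smooth_P.mul h.smooth_b2)

theorem smooth_g11 (h : SmoothCoeffs P Q R S) : Smooth₂ (g11 P Q R S) :=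
  (h.smooth_b2.pdx.sub (h.smooth_R.mul h.smooth_b1)).add (h.smooth_Q.mul h.smooth_b2)

theorem smooth_g20 (h : SmoothCoeffs P Q R S) : Smooth₂ (g20 P Q R S) :=
  (h.smooth_b1.pdy.sub (h.smooth_R.mul h.smooth_b1)).add (h.smooth_Q.mul h.smooth_b2)

theorem smooth_g21 (h : SmoothCoeffs P Q R S) : Smooth₂ (g21 P Q R S) :=
  (h.smooth_b2.pdy.sub (h.smooth_S.mul h.smooth_b1)).add (h.smooth_R.mul h.smooth_b2)

theorem AA_eq_b1 (h : SmoothCoeffs P Q R S) : AA P Q R S = b1 P Q R S := by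
  funext x y
  unfold AA b1 al0 al1 al2
  simp (maxDischargeDepth := 30) only [h.smooth_P, h.smooth_Q, h.smooth_R, h.smooth_S,
    Smooth₂.const, Smooth₂.add, Smooth₂.sub, Smooth₂.mul, Smooth₂.pow, Smooth₂.pdx, Smooth₂.pdy,
    Smooth₂.pdy_pdx, isPartial_pdx.add, isPartial_pdx.sub, isPartial_pdx.mul, isPartial_pdy.const,
    isPartial_pdy.add, isPartial_pdy.sub, isPartial_pdy.mul, isPartial_pdy.pow]
  norm_num
  ring

theorem BB_eq_b2 (h : SmoothCoeffs P Q R S) : BB P Q R S = b2 P Q R S := by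
  funext x y
  unfold BB b2 al0 al1 al2
  simp (maxDischargeDepth := 30) only [h.smooth_P, h.smooth_Q, h.smooth_R, h.smooth_S,
    Smooth₂.const, Smooth₂.add, Smooth₂.sub, Smooth₂.mul, Smooth₂.pow, Smooth₂.pdx, Smooth₂.pdy,
    Smooth₂.pdy_pdx, isPartial_pdx.const, isPartial_pdx.add, isPartial_pdx.sub, isPartial_pdx.mul,
    isPartial_pdx.pow, isPartial_pdy.add, isPartial_pdy.sub, isPartial_pdy.mul]
  norm_num
  ring

/-- Ricci identity for the first component of the covector `(b1, b2)`. -/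
theorem ricci_g20_g10 (h : SmoothCoeffs P Q R S) (x y : ℝ) :
    pdy (g10 P Q R S) x y - 2 * R x y * g10 P Q R S x y
        + Q x y * (g20 P Q R S x y + g11 P Q R S x y) =
      pdx (g20 P Q R S) x y - R x y * g10 P Q R S x y + P x y * g21 P Q R S x y
        - (-al1 P Q R S x y * b1 P Q R S x y + al0 P Q R S x y * b2 P Q R S x y) := by
  unfold g10 g11 g20 g21 al0 al1
  simp (maxDischargeDepth := 30) only [h.smooth_P, h.smooth_Q, h.smooth_R, h.smooth_b1, h.smooth_b2,
    Smooth₂.sub, Smooth₂.mul, Smooth₂.pdx, Smooth₂.pdy, Smooth₂.pdy_pdx, isPartial_pdx.add,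
    isPartial_pdx.sub, isPartial_pdx.mul, isPartial_pdy.add, isPartial_pdy.sub, isPartial_pdy.mul]
  ring

/-- Ricci identity for the second component of the covector `(b1, b2)`. -/
theorem ricci_g21_g11 (h : SmoothCoeffs P Q R S) (x y : ℝ) :
    pdy (g11 P Q R S) x y - S x y * g10 P Q R S x y + Q x y * g21 P Q R S x y =
      pdx (g21 P Q R S) x y - R x y * (g20 P Q R S x y + g11 P Q R S x y)
        + 2 * Q x y * g21 P Q R S x y
        - (-al2 P Q R S x y * b1 P Q R S x y + al1 P Q R S x y * b2 P Q R S x y) := by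
  unfold g10 g11 g20 g21 al1 al2
  simp (maxDischargeDepth := 30) only [h.smooth_Q, h.smooth_R, h.smooth_S, h.smooth_b1, h.smooth_b2,
    Smooth₂.sub, Smooth₂.mul, Smooth₂.pdx, Smooth₂.pdy, Smooth₂.pdy_pdx, isPartial_pdx.add,
    isPartial_pdx.sub, isPartial_pdx.mul, isPartial_pdy.add, isPartial_pdy.sub, isPartial_pdy.mul]
  ring

theorem GG_eq (h : SmoothCoeffs P Q R S) :
    GG P Q R S = fun x y => 4 * b2 P Q R S x y * g20 P Q R S x y
      - b2 P Q R S x y * g11 P Q R S x y - 3 * b1 P Q R S x y * g21 P Q R S x y := by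
  funext x y
  simp only [GG, h.AA_eq_b1, h.BB_eq_b2, g11, g20, g21]
  ring

theorem HH_eq (h : SmoothCoeffs P Q R S) :
    HH P Q R S = fun x y => 4 * b1 P Q R S x y * g11 P Q R S x y
      - b1 P Q R S x y * g20 P Q R S x y - 3 * b2 P Q R S x y * g10 P Q R S x y := by
  funext x y
  simp only [HH, h.AA_eq_b1, h.BB_eq_b2, g10, g11, g20]
  ring

theorem three_mul_Phi (h : SmoothCoeffs P Q R S) (x y : ℝ) :
    3 * Phi P Q R S x y =
      b1 P Q R S x y * GG P Q R S x y + b2 P Q R S x y * HH P Q R S x y := by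
  simp only [GG, HH, Phi, h.AA_eq_b1, h.BB_eq_b2]
  ring

theorem smooth_GG (h : SmoothCoeffs P Q R S) : Smooth₂ (GG P Q R S) := by
  rw [h.GG_eq]
  exact ((((Smooth₂.const 4).mul h.smooth_b2).mul h.smooth_g20).sub
    (h.smooth_b2.mul h.smooth_g11)).sub
    (((Smooth₂.const 3).mul h.smooth_b1).mul h.smooth_g21)

theorem smooth_HH (h : SmoothCoeffs P Q R S) : Smooth₂ (HH P Q R S) := by
  rw [h.HH_eq]
  exact ((((Smooth₂.const 4).mul h.smooth_b1).mul h.smooth_g11).sub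
    (h.smooth_b1.mul h.smooth_g20)).sub
    (((Smooth₂.const 3).mul h.smooth_b2).mul h.smooth_g10)

theorem smooth_kap (h : SmoothCoeffs P Q R S) : Smooth₂ (kap P Q R S) :=
  ((Smooth₂.const _).mul ((h.smooth_g10.mul h.smooth_g21).sub (h.smooth_g20.mul h.smooth_g11))).sub
    ((Smooth₂.const _).mul ((h.smooth_g20.sub h.smooth_g11).pow 2))

theorem partial_GG (h : SmoothCoeffs P Q R S) (hD : IsPartial D) (x y : ℝ) :
    D (GG P Q R S) x y =
      4 * (D (b2 P Q R S) x y * g20 P Q R S x y + b2 P Q R S x y * D (g20 P Q R S) x y)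
        - (D (b2 P Q R S) x y * g11 P Q R S x y + b2 P Q R S x y * D (g11 P Q R S) x y)
        - 3 * (D (b1 P Q R S) x y * g21 P Q R S x y + b1 P Q R S x y * D (g21 P Q R S) x y) := by
  rw [h.GG_eq]
  simp (maxDischargeDepth := 30) only [h.smooth_b1, h.smooth_b2, h.smooth_g11, h.smooth_g20,
    h.smooth_g21, Smooth₂.const, Smooth₂.sub, Smooth₂.mul, hD.const, hD.sub, hD.mul]
  ring

theorem partial_HH (h : SmoothCoeffs P Q R S) (hD : IsPartial D) (x y : ℝ) :
    D (HH P Q R S) x y =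
      4 * (D (b1 P Q R S) x y * g11 P Q R S x y + b1 P Q R S x y * D (g11 P Q R S) x y)
        - (D (b1 P Q R S) x y * g20 P Q R S x y + b1 P Q R S x y * D (g20 P Q R S) x y)
        - 3 * (D (b2 P Q R S) x y * g10 P Q R S x y + b2 P Q R S x y * D (g10 P Q R S) x y) := by
  rw [h.HH_eq]
  simp (maxDischargeDepth := 30) only [h.smooth_b1, h.smooth_b2, h.smooth_g10, h.smooth_g11,
    h.smooth_g20, Smooth₂.const, Smooth₂.sub, Smooth₂.mul, hD.const, hD.sub, hD.mul]
  ring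

theorem partial_kap (h : SmoothCoeffs P Q R S) (hD : IsPartial D) (x y : ℝ) :
    D (kap P Q R S) x y =
      -9 * (D (g10 P Q R S) x y * g21 P Q R S x y + g10 P Q R S x y * D (g21 P Q R S) x y
          - D (g20 P Q R S) x y * g11 P Q R S x y - g20 P Q R S x y * D (g11 P Q R S) x y)
        - 8 * (g20 P Q R S x y - g11 P Q R S x y)
          * (D (g20 P Q R S) x y - D (g11 P Q R S) x y) := by
  unfold kap
  simp (maxDischargeDepth := 30) only [h.smooth_g10, h.smooth_g11, h.smooth_g20, h.smooth_g21,
    Smooth₂.const, Smooth₂.pow, Smooth₂.sub, Smooth₂.mul, hD.const, hD.sub, hD.mul, hD.pow]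
  norm_num
  ring

theorem quadratic_GG_HH (h : SmoothCoeffs P Q R S) (x y : ℝ) :
    GG P Q R S x y ^ 2 * g10 P Q R S x y
        + GG P Q R S x y * HH P Q R S x y * (g20 P Q R S x y + g11 P Q R S x y)
        + HH P Q R S x y ^ 2 * g21 P Q R S x y = Phi P Q R S x y * kap P Q R S x y := by
  have hΦ := h.three_mul_Phi x y
  rw [h.GG_eq, h.HH_eq] at hΦ ⊢
  unfold kap
  linear_combination -1 / 3 *
    (-9 * (g10 P Q R S x y * g21 P Q R S x y - g20 P Q R S x y * g11 P Q R S x y)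
      - 4 * (g20 P Q R S x y - g11 P Q R S x y) ^ 2) * hΦ

theorem partial_root (h : SmoothCoeffs P Q R S) (hD : IsPartial D)
    (hF : Smooth₂ F) (hF5 : ∀ x y : ℝ, F x y ^ 5 = Phi P Q R S x y) (x y : ℝ) :
    15 * F x y ^ 4 * D F x y =
      D (b1 P Q R S) x y * GG P Q R S x y + b1 P Q R S x y * D (GG P Q R S) x y
        + D (b2 P Q R S) x y * HH P Q R S x y + b2 P Q R S x y * D (HH P Q R S) x y := by
  have hΦ : (fun x y => 3 * F x y ^ 5) = fun x y =>
      b1 P Q R S x y * GG P Q R S x y + b2 P Q R S x y * HH P Q R S x y := by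
    funext x y
    rw [hF5, h.three_mul_Phi]
  have hDΦ := congrFun₂ (congrArg D hΦ) x y
  rw [hD.mul (Smooth₂.const 3) (hF.pow 5), hD.pow 5 hF, hD.const,
    hD.add (h.smooth_b1.mul h.smooth_GG) (h.smooth_b2.mul h.smooth_HH),
    hD.mul h.smooth_b1 h.smooth_GG, hD.mul h.smooth_b2 h.smooth_HH] at hDΦ
  norm_num at hDΦ
  linear_combination hDΦ

theorem I6v_eq (h : SmoothCoeffs P Q R S) :
    I6v P Q R S F = fun x y =>
      1 / 3 * ((g20 P Q R S x y - g11 P Q R S x y) * (F x y)⁻¹ ^ 2)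
        + 1 / 3 * ((b2 P Q R S x y * pdx F x y - b1 P Q R S x y * pdy F x y) * (F x y)⁻¹ ^ 3) := by
  funext x y
  simp only [I6v, h.AA_eq_b1, h.BB_eq_b2, g20, g11]
  ring

theorem I8v_eq (h : SmoothCoeffs P Q R S)
    (hF : Smooth₂ F) (hF5 : ∀ x y : ℝ, F x y ^ 5 = Phi P Q R S x y)
    (hFne : ∀ x y : ℝ, F x y ≠ 0) :
    I8v P Q R S F = fun x y =>
      5 / 3 * ((GG P Q R S x y * pdx F x y + HH P Q R S x y * pdy F x y) * (F x y)⁻¹ ^ 5)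
        - 1 / 3 * (kap P Q R S x y * (F x y)⁻¹ ^ 4) := by
  funext x y
  have hx := h.partial_root isPartial_pdx hF hF5 x y
  have hy := h.partial_root isPartial_pdy hF hF5 x y
  have hk := h.quadratic_GG_HH x y
  have h0 := hFne x y
  rw [← hF5] at hk
  simp only [I8v, h.AA_eq_b1, h.BB_eq_b2]
  simp only [g10, g11, g20, g21] at hk
  field_simp
  linear_combination -GG P Q R S x y * hx - HH P Q R S x y * hy - hk

theorem I3v_eq (h : SmoothCoeffs P Q R S)
    (hF : Smooth₂ F) (hF5 : ∀ x y : ℝ, F x y ^ 5 = Phi P Q R S x y)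
    (hFne : ∀ x y : ℝ, F x y ≠ 0) (x y : ℝ) :
    I3v P Q R S F x y =
      (3 * (pdx (GG P Q R S) x y + pdy (HH P Q R S) x y) + kap P Q R S x y) / (3 * F x y ^ 4)
        - 14 * (GG P Q R S x y * pdx F x y + HH P Q R S x y * pdy F x y) / (3 * F x y ^ 5) := by
  have hx := h.partial_root isPartial_pdx hF hF5 x y
  have hy := h.partial_root isPartial_pdy hF hF5 x y
  have hk := h.quadratic_GG_HH x y
  have hΦ := h.three_mul_Phi x y
  have h0 := hFne x y
  rw [← hF5] at hk hΦ
  simp only [I3v, h.AA_eq_b1, h.BB_eq_b2]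
  simp only [g10, g11, g20, g21] at hk
  field_simp
  linear_combination GG P Q R S x y * hx + HH P Q R S x y * hy + hk
    - (pdx (GG P Q R S) x y + pdy (HH P Q R S) x y) * hΦ

theorem partial_I6v (h : SmoothCoeffs P Q R S) (hD : IsPartial D) (hF : Smooth₂ F)
    (hFne : ∀ x y : ℝ, F x y ≠ 0) (x y : ℝ) :
    D (I6v P Q R S F) x y =
      1 / 3 * ((D (g20 P Q R S) x y - D (g11 P Q R S) x y) / F x y ^ 2
        - 2 * (g20 P Q R S x y - g11 P Q R S x y) * D F x y / F x y ^ 3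
        + (D (b2 P Q R S) x y * pdx F x y + b2 P Q R S x y * D (pdx F) x y
          - D (b1 P Q R S) x y * pdy F x y - b1 P Q R S x y * D (pdy F) x y) / F x y ^ 3
        - 3 * (b2 P Q R S x y * pdx F x y - b1 P Q R S x y * pdy F x y) * D F x y / F x y ^ 4) := by
  rw [h.I6v_eq]
  simp (maxDischargeDepth := 30) only [h.smooth_b1, h.smooth_b2, h.smooth_g11, h.smooth_g20, hF,
    hFne, ne_eq, not_false_eq_true, implies_true, Smooth₂.const, Smooth₂.sub, Smooth₂.mul,
    Smooth₂.pow, Smooth₂.inv, Smooth₂.pdx, Smooth₂.pdy, hD.const, hD.add, hD.sub, hD.mul, hD.pow,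
    hD.inv]
  norm_num
  ring

theorem partial_I8v (h : SmoothCoeffs P Q R S) (hD : IsPartial D)
    (hF : Smooth₂ F) (hF5 : ∀ x y : ℝ, F x y ^ 5 = Phi P Q R S x y)
    (hFne : ∀ x y : ℝ, F x y ≠ 0) (x y : ℝ) :
    D (I8v P Q R S F) x y =
      5 / 3 * ((D (GG P Q R S) x y * pdx F x y + GG P Q R S x y * D (pdx F) x y
          + D (HH P Q R S) x y * pdy F x y + HH P Q R S x y * D (pdy F) x y) / F x y ^ 5
        - 5 * (GG P Q R S x y * pdx F x y + HH P Q R S x y * pdy F x y) * D F x y / F x y ^ 6)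
      - 1 / 3 * (D (kap P Q R S) x y / F x y ^ 4 - 4 * kap P Q R S x y * D F x y / F x y ^ 5) := by
  rw [h.I8v_eq hF hF5 hFne]
  simp (maxDischargeDepth := 30) only [h.smooth_GG, h.smooth_HH, h.smooth_kap, hF, hFne, ne_eq,
    not_false_eq_true, implies_true, Smooth₂.const, Smooth₂.add, Smooth₂.mul, Smooth₂.pow,
    Smooth₂.inv, Smooth₂.pdx, Smooth₂.pdy, hD.const, hD.add, hD.sub, hD.mul, hD.pow, hD.inv]
  norm_num
  ring

end SmoothCoeffs

/-- The relation between the second-order jet of a covector field `(A, B)`, its covariant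
derivatives, and the relative invariants built from them. -/
theorem covariant_jet_identity
    {A B c10 c11 c20 c21 a0 a1 a2 x10 x20 y20 x11 x21 y21 y10 y11 G H Gx Gy Hx Hy Φ Φx Φy
      D κ κx κy : ℝ}
    (hy10 : y10 = x20 - (-a1 * A + a0 * B)) (hy11 : y11 = x21 - (-a2 * A + a1 * B))
    (hG : G = 4 * B * c20 - B * c11 - 3 * A * c21)
    (hH : H = -A * c20 - 3 * B * c10 + 4 * A * c11)
    (hGx : Gx = 4 * c11 * c20 + 4 * B * x20 - c11 * c11 - B * x11 - 3 * c10 * c21 - 3 * A * x21)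
    (hGy : Gy = 4 * c21 * c20 + 4 * B * y20 - c21 * c11 - B * y11 - 3 * c20 * c21 - 3 * A * y21)
    (hHx : Hx = -c10 * c20 - A * x20 - 3 * c11 * c10 - 3 * B * x10 + 4 * c10 * c11 + 4 * A * x11)
    (hHy : Hy = -c20 * c20 - A * y20 - 3 * c21 * c10 - 3 * B * y10 + 4 * c20 * c11 + 4 * A * y11)
    (hΦ : 3 * Φ = A * G + B * H)
    (hΦx : 3 * Φx = c10 * G + A * Gx + c11 * H + B * Hx)
    (hΦy : 3 * Φy = c20 * G + A * Gy + c21 * H + B * Hy)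
    (hD : D = c20 - c11)
    (hκ : κ = -9 * (c10 * c21 - c20 * c11) - 4 * D ^ 2)
    (hκx : κx = -9 * (x10 * c21 + c10 * x21 - x20 * c11 - c20 * x11) - 8 * D * (x20 - x11))
    (hκy : κy = -9 * (y10 * c21 + c10 * y21 - y20 * c11 - c20 * y11) - 8 * D * (y20 - y11)) :
    3 * Φ * (G * (x20 - x11 - 3 * a1 * A + 3 * a0 * B)
        - H * ((x21 - 5 * a1 * B) - (y20 - 4 * a2 * A - a1 * B))
        + 3 * D * (c10 * c21 - c20 * c11) + 4 / 3 * D ^ 3) =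
      -(H * (G * Gx + H * Gy) - G * (G * Hx + H * Hy))
        + 3 * (((G * c11 + H * c21) - (B * Gx - A * Gy)) * Φx
          + (-(G * c10 + H * c20) - (B * Hx - A * Hy)) * Φy)
        - 12 * D * (G * Φx + H * Φy) + 3 * (B * Φx - A * Φy) * (Gx + Hy - κ)
        + 3 * Φ * ((B * κx - A * κy) + 5 * (G * (x20 - x11) + H * (y20 - y11))
          + D * (5 * (Gx + Hy) - κ)) := by
  obtain rfl : Φ = (A * G + B * H) / 3 := by linarith
  obtain rfl : Φx = (c10 * G + A * Gx + c11 * H + B * Hx) / 3 := by linarith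
  obtain rfl : Φy = (c20 * G + A * Gy + c21 * H + B * Hy) / 3 := by linarith
  subst_vars
  ring

theorem stmt11 (P Q R S : ℝ → ℝ → ℝ)
    (hP : ContDiff ℝ (⊤ : ℕ∞) (uncurry P)) (hQ : ContDiff ℝ (⊤ : ℕ∞) (uncurry Q))
    (hR : ContDiff ℝ (⊤ : ℕ∞) (uncurry R)) (hS : ContDiff ℝ (⊤ : ℕ∞) (uncurry S)) (F : ℝ → ℝ → ℝ)
    (hF : ContDiff ℝ (⊤ : ℕ∞) (uncurry F)) (hF5 : ∀ x y : ℝ, F x y ^ 5 = Phi P Q R S x y) (hFne : ∀ x y : ℝ, F x y ≠ 0) :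
    ∀ x y : ℝ,
      J2 P Q R S x y =
        (- I7v P Q R S F x y - 3 * XX P Q R S F (I8v P Q R S F) x y
          + 15 * YY P Q R S F (I6v P Q R S F) x y
          + (24 * I8v P Q R S F x y + 15 * I3v P Q R S F x y) * I6v P Q R S F x y) * F x y ^ 6 := by
  intro x y
  have h : SmoothCoeffs P Q R S := ⟨hP, hQ, hR, hS⟩
  replace hF : Smooth₂ F := hF
  have hAx : pdx (b1 P Q R S) x y = g10 P Q R S x y + Q x y * b1 P Q R S x y
      - P x y * b2 P Q R S x y := by unfold g10; ring
  have hBx : pdx (b2 P Q R S) x y = g11 P Q R S x y + R x y * b1 P Q R S x y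
      - Q x y * b2 P Q R S x y := by unfold g11; ring
  have hAy : pdy (b1 P Q R S) x y = g20 P Q R S x y + R x y * b1 P Q R S x y
      - Q x y * b2 P Q R S x y := by unfold g20; ring
  have hBy : pdy (b2 P Q R S) x y = g21 P Q R S x y + S x y * b1 P Q R S x y
      - R x y * b2 P Q R S x y := by unfold g21; ring
  have hG := congrFun₂ h.GG_eq x y
  have hH := congrFun₂ h.HH_eq x y
  have hGx := h.partial_GG isPartial_pdx x y
  have hGy := h.partial_GG isPartial_pdy x y
  have hHx := h.partial_HH isPartial_pdx x y
  have hHy := h.partial_HH isPartial_pdy x y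
  have hFx := h.partial_root isPartial_pdx hF hF5 x y
  have hFy := h.partial_root isPartial_pdy hF hF5 x y
  have hΦ := h.three_mul_Phi x y
  rw [← hF5] at hΦ
  have h0 := hFne x y
  rw [hAx, hBx] at hFx hGx hHx
  rw [hAy, hBy] at hFy hGy hHy
  have key := covariant_jet_identity
    (x10 := pdx (g10 P Q R S) x y - 2 * Q x y * g10 P Q R S x y
      + P x y * (g20 P Q R S x y + g11 P Q R S x y))
    (x20 := pdx (g20 P Q R S) x y - R x y * g10 P Q R S x y + P x y * g21 P Q R S x y)
    (y20 := pdy (g20 P Q R S) x y - S x y * g10 P Q R S x y + Q x y * g21 P Q R S x y)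
    (x11 := pdx (g11 P Q R S) x y - R x y * g10 P Q R S x y + P x y * g21 P Q R S x y)
    (x21 := pdx (g21 P Q R S) x y - R x y * (g20 P Q R S x y + g11 P Q R S x y)
      + 2 * Q x y * g21 P Q R S x y)
    (y21 := pdy (g21 P Q R S) x y - S x y * (g20 P Q R S x y + g11 P Q R S x y)
      + 2 * R x y * g21 P Q R S x y)
    (Gx := pdx (GG P Q R S) x y + Q x y * GG P Q R S x y + R x y * HH P Q R S x y)
    (Gy := pdy (GG P Q R S) x y + R x y * GG P Q R S x y + S x y * HH P Q R S x y)
    (Hx := pdx (HH P Q R S) x y - P x y * GG P Q R S x y - Q x y * HH P Q R S x y)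
    (Hy := pdy (HH P Q R S) x y - Q x y * GG P Q R S x y - R x y * HH P Q R S x y)
    (Φx := 5 * F x y ^ 4 * pdx F x y) (Φy := 5 * F x y ^ 4 * pdy F x y)
    (κ := kap P Q R S x y) (κx := pdx (kap P Q R S) x y) (κy := pdy (kap P Q R S) x y)
    (h.ricci_g20_g10 x y) (h.ricci_g21_g11 x y)
    hG (by rw [hH]; ring)
    (by rw [hGx, hG, hH]; ring) (by rw [hGy, hG, hH]; ring)
    (by rw [hHx, hG, hH]; ring) (by rw [hHy, hG, hH]; ring)
    hΦ (by linear_combination hFx) (by linear_combination hFy) rfl rfl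
    (by rw [h.partial_kap isPartial_pdx]; ring) (by rw [h.partial_kap isPartial_pdy]; ring)
  have hΓ₁ : Gam1 P Q R S x y = GG P Q R S x y := by rw [hG, Gam1]; ring
  have hΓ₀ : Gam0 P Q R S x y = -HH P Q R S x y := by rw [hH, Gam0]; ring
  simp only [XX, YY, J2, I7v, hΓ₁, hΓ₀, d20, d11, d21, d30, h.partial_I8v isPartial_pdx hF hF5 hFne,
    h.partial_I8v isPartial_pdy hF hF5 hFne, h.partial_I6v isPartial_pdx hF hFne,
    h.partial_I6v isPartial_pdy hF hFne]
  simp only [h.I3v_eq hF hF5 hFne, h.I6v_eq, h.I8v_eq hF hF5 hFne, h.AA_eq_b1, h.BB_eq_b2,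
    hF.pdy_pdx, hAx, hAy, hBx, hBy]
  refine mul_left_cancel₀ (mul_ne_zero three_ne_zero (pow_ne_zero 5 h0)) ?_
  field_simp
  linear_combination 3 * key
end
end

section
/- The two formulas (4.9) and (4.10) for the scalar invariant I₆ give the same result: in the case of general position, A(GA_y + HB_y)/(12F⁷) − B(GA_x + HB_x)/(12F⁷) − 4(AF_y − BF_x)/(12F³) − GB²P/(12F⁷) − (HB² − 2GBA)Q/(12F⁷) − (GA² − 2HBA)R/(12F⁷) − HA²S/(12F⁷) = (A_y − B_x)/(3F²) − (AF_y − BF_x)/(3F³), identically on ℝ². -/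
open Function

noncomputable section

theorem stmt13 (P Q R S : ℝ → ℝ → ℝ)
    (hP : ContDiff ℝ (⊤ : ℕ∞) (uncurry P)) (hQ : ContDiff ℝ (⊤ : ℕ∞) (uncurry Q))
    (hR : ContDiff ℝ (⊤ : ℕ∞) (uncurry R)) (hS : ContDiff ℝ (⊤ : ℕ∞) (uncurry S)) (F : ℝ → ℝ → ℝ)
    (hF : ContDiff ℝ (⊤ : ℕ∞) (uncurry F)) (hF5 : ∀ x y : ℝ, F x y ^ 5 = Phi P Q R S x y) (hFne : ∀ x y : ℝ, F x y ≠ 0) :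
    ∀ x y : ℝ,
      AA P Q R S x y * (GG P Q R S x y * pdy (AA P Q R S) x y + HH P Q R S x y * pdy (BB P Q R S) x y) / (12 * F x y ^ 7)
        - BB P Q R S x y * (GG P Q R S x y * pdx (AA P Q R S) x y + HH P Q R S x y * pdx (BB P Q R S) x y) / (12 * F x y ^ 7)
        - 4 * (AA P Q R S x y * pdy F x y - BB P Q R S x y * pdx F x y) / (12 * F x y ^ 3)
        - GG P Q R S x y * BB P Q R S x y ^ 2 * P x y / (12 * F x y ^ 7)
        - (HH P Q R S x y * BB P Q R S x y ^ 2 - 2 * GG P Q R S x y * BB P Q R S x y * AA P Q R S x y) * Q x y / (12 * F x y ^ 7)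
        - (GG P Q R S x y * AA P Q R S x y ^ 2 - 2 * HH P Q R S x y * BB P Q R S x y * AA P Q R S x y) * R x y / (12 * F x y ^ 7)
        - HH P Q R S x y * AA P Q R S x y ^ 2 * S x y / (12 * F x y ^ 7)
      = (pdy (AA P Q R S) x y - pdx (BB P Q R S) x y) / (3 * F x y ^ 2) - (AA P Q R S x y * pdy F x y - BB P Q R S x y * pdx F x y) / (3 * F x y ^ 3) := by
  intro x y
  have h5 := hF5 x y
  have hne := hFne x y
  unfold Phi at h5
  unfold GG HH
  generalize AA P Q R S = A at *
  generalize BB P Q R S = B at *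
  field_simp
  linear_combination -12 * (pdy A x y - pdx B x y) * h5
end
end
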